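/- Let P' ⊆ ℝ^p be a nonempty polytope, a ∈ ℝ^p \ {0} and β ∈ ℝ such that P' ⊆ H^≤(a,β) = {x : ⟨a,x⟩ ≤ β}. Let φ_H(x) = x + 2·((β − ⟨a,x⟩)/‖a‖²)·a be the reflection through the hyperplane H = {x : ⟨a,x⟩ = β}. Then xc(conv(P' ∪ φ_H(P'))) ≤ xc(P') + 2. -/

import Mathlib

/-- `P` admits an extended formulation with `m` inequalities (and finitely many
linear equations): a feasible region in some `ℝ^q` projecting linearly onto `P`. -/
def IsExtFormulation {p : ℕ} (P : Set (Fin p → ℝ)) (m : ℕ) : Prop :=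
  ∃ (q s : ℕ) (A : Matrix (Fin m) (Fin q) ℝ) (b : Fin m → ℝ)
    (C : Matrix (Fin s) (Fin q) ℝ) (d : Fin s → ℝ)
    (π : (Fin q → ℝ) →ₗ[ℝ] (Fin p → ℝ)),
    π '' {y | A.mulVec y ≤ b ∧ C.mulVec y = d} = P

/-- The extension complexity of `P`: the smallest number of inequalities in any
extended formulation for `P`. -/
noncomputable def xc {p : ℕ} (P : Set (Fin p → ℝ)) : ℕ :=
  sInf {m | IsExtFormulation P m}

/-- A polytope is the convex hull of a finite set of points. -/
def IsPolytope {p : ℕ} (P : Set (Fin p → ℝ)) : Prop :=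
  ∃ V : Finset (Fin p → ℝ), P = convexHull ℝ (V : Set (Fin p → ℝ))

/-- A linear image of the feasible region of finitely many linear inequalities and equations in
a finite-dimensional space has an extended formulation with that number of inequalities. -/
theorem isExtFormulation_of_linearMap {p : ℕ} {E ι σ : Type*} [AddCommGroup E] [Module ℝ E]
    [FiniteDimensional ℝ E] [Fintype ι] [Fintype σ] (f : ι → E →ₗ[ℝ] ℝ) (b : ι → ℝ)
    (g : σ → E →ₗ[ℝ] ℝ) (d : σ → ℝ) (π : E →ₗ[ℝ] (Fin p → ℝ)) :
    IsExtFormulation (π '' {y | (∀ i, f i y ≤ b i) ∧ ∀ j, g j y = d j}) (Fintype.card ι) := by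
  let e : E ≃ₗ[ℝ] (Fin (Module.finrank ℝ E) → ℝ) := (Module.finBasis ℝ E).equivFun
  let eι := Fintype.equivFin ι
  let eσ := Fintype.equivFin σ
  refine ⟨Module.finrank ℝ E, Fintype.card σ,
    LinearMap.toMatrix' (LinearMap.pi fun i => f (eι.symm i) ∘ₗ e.symm.toLinearMap),
    b ∘ eι.symm,
    LinearMap.toMatrix' (LinearMap.pi fun j => g (eσ.symm j) ∘ₗ e.symm.toLinearMap),
    d ∘ eσ.symm, π ∘ₗ e.symm.toLinearMap, ?_⟩
  ext x
  simp only [LinearMap.toMatrix'_mulVec, Set.mem_image, Set.mem_ofPred_eq, Pi.le_def, funext_iff,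
    LinearMap.pi_apply, LinearMap.comp_apply, LinearEquiv.coe_coe, Function.comp_apply]
  constructor
  · rintro ⟨y, ⟨h₁, h₂⟩, hx⟩
    exact ⟨e.symm y, ⟨fun i => by simpa using h₁ (eι i), fun j => by simpa using h₂ (eσ j)⟩, hx⟩
  · rintro ⟨y, ⟨h₁, h₂⟩, hx⟩
    exact ⟨e y, ⟨fun i => by simpa using h₁ (eι.symm i), fun j => by simpa using h₂ (eσ.symm j)⟩,
      by simpa using hx⟩

/-- Every polytope has an extended formulation: it is a projection of a simplex. -/
theorem IsPolytope.exists_isExtFormulation {p : ℕ} {P : Set (Fin p → ℝ)} (hP : IsPolytope P) :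
    ∃ m, IsExtFormulation P m := by
  obtain ⟨V, rfl⟩ := hP
  rw [V.finite_toSet.convexHull_eq_image]
  let _ := V.finite_toSet.fintype
  have h := isExtFormulation_of_linearMap (E := ↥(V : Set (Fin p → ℝ)) → ℝ)
    (fun v => -LinearMap.proj v) (fun _ => 0) (fun _ : Unit => ∑ v, LinearMap.proj v)
    (fun _ => 1) (∑ v, (LinearMap.proj v).smulRight v.1)
  refine ⟨Fintype.card ↥(V : Set (Fin p → ℝ)), ?_⟩
  convert h using 2
  ext y
  simp [stdSimplex]

/-- The set swept out by moving each point `v` of `P` along `a` up to its mirror image in the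
hyperplane `⟨a, x⟩ = β` is the convex hull of `P` and its mirror image. -/
theorem convexHull_union_reflection {p : ℕ} {P : Set (Fin p → ℝ)} (hP : Convex ℝ P)
    {a : Fin p → ℝ} (ha : a ≠ 0) {β : ℝ} (hsub : ∀ x ∈ P, (∑ i, a i * x i) ≤ β)
    {φ : (Fin p → ℝ) → (Fin p → ℝ)}
    (hφ : ∀ x, φ x = x + (2 * (β - ∑ i, a i * x i) / (∑ i, a i ^ 2)) • a) :
    convexHull ℝ (P ∪ φ '' P) =
      {x | ∃ v ∈ P, ∃ t : ℝ, 0 ≤ t ∧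
        t * (∑ i, a i ^ 2) + 2 * ∑ i, a i * v i ≤ 2 * β ∧ v + t • a = x} := by
  have hpos : 0 < ∑ i, a i ^ 2 := by
    obtain ⟨i, hi⟩ := Function.ne_iff.1 ha
    exact Finset.sum_pos' (fun i _ => sq_nonneg _) ⟨i, Finset.mem_univ i, by
      have : a i ≠ 0 := hi
      positivity⟩
  apply Set.Subset.antisymm
  · apply convexHull_min
    · rintro x (hx | ⟨v, hv, rfl⟩)
      · exact ⟨x, hx, 0, le_rfl, by linarith [hsub x hx], by simp⟩
      · refine ⟨v, hv, _, ?_, ?_, (hφ v).symm⟩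
        · have := hsub v hv
          exact div_nonneg (by linarith) hpos.le
        · rw [div_mul_cancel₀ _ hpos.ne']
          linarith
    · rintro _ ⟨v, hv, t, ht, hvt, rfl⟩ _ ⟨w, hw, s, hs, hws, rfl⟩ c d hc hd hcd
      refine ⟨c • v + d • w, hP hv hw hc hd hcd, c * t + d * s, by positivity, ?_, by module⟩
      have hsum : ∑ i, a i * (c • v + d • w) i = c * ∑ i, a i * v i + d * ∑ i, a i * w i := by
        rw [Finset.mul_sum, Finset.mul_sum, ← Finset.sum_add_distrib]
        refine Finset.sum_congr rfl fun i _ => ?_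
        simp only [Pi.add_apply, Pi.smul_apply, smul_eq_mul]
        ring
      rw [hsum]
      have h₁ := mul_le_mul_of_nonneg_left hvt hc
      have h₂ := mul_le_mul_of_nonneg_left hws hd
      have h₃ : c * (2 * β) + d * (2 * β) = 2 * β := by rw [← add_mul, hcd, one_mul]
      linarith
  · rintro _ ⟨v, hv, t, ht, hvt, rfl⟩
    have hseg : segment ℝ v (φ v) ⊆ convexHull ℝ (P ∪ φ '' P) :=
      segment_subset_convexHull (Or.inl hv) (Or.inr ⟨v, hv, rfl⟩)
    apply hseg
    have hle : t ≤ 2 * (β - ∑ i, a i * v i) / ∑ i, a i ^ 2 := by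
      rw [le_div_iff₀ hpos]
      linarith
    rw [segment_eq_image']
    obtain h | h := (ht.trans hle).eq_or_lt
    · have : t = 0 := le_antisymm (h ▸ hle) ht
      exact ⟨0, by simp, by simp [this]⟩
    · refine ⟨t / (2 * (β - ∑ i, a i * v i) / ∑ i, a i ^ 2),
        ⟨by positivity, (div_le_one h).2 hle⟩, ?_⟩
      simp only [hφ v, add_sub_cancel_left, smul_smul]
      rw [div_mul_cancel₀ _ h.ne']

/-- Adding the mirror image costs at most two further inequalities. -/
theorem IsExtFormulation.convexHull_union_reflection {p m : ℕ} {P : Set (Fin p → ℝ)}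
    (hm : IsExtFormulation P m) (hP : Convex ℝ P) {a : Fin p → ℝ} (ha : a ≠ 0) {β : ℝ}
    (hsub : ∀ x ∈ P, (∑ i, a i * x i) ≤ β) {φ : (Fin p → ℝ) → (Fin p → ℝ)}
    (hφ : ∀ x, φ x = x + (2 * (β - ∑ i, a i * x i) / (∑ i, a i ^ 2)) • a) :
    IsExtFormulation (convexHull ℝ (P ∪ φ '' P)) (m + 2) := by
  rw [_root_.convexHull_union_reflection hP ha hsub hφ]
  obtain ⟨q, s, A, b, C, d, π, rfl⟩ := hm
  let fstL : (Fin q → ℝ) × ℝ →ₗ[ℝ] (Fin q → ℝ) := LinearMap.fst ℝ _ _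
  let sndL : (Fin q → ℝ) × ℝ →ₗ[ℝ] ℝ := LinearMap.snd ℝ _ _
  have h := isExtFormulation_of_linearMap
    (Sum.elim (fun i : Fin m => LinearMap.proj i ∘ₗ A.mulVecLin ∘ₗ fstL)
      ![-sndL, (∑ i, a i ^ 2) • sndL + (2 : ℝ) • ∑ i, a i • (LinearMap.proj i ∘ₗ π ∘ₗ fstL)])
    (Sum.elim b ![0, 2 * β])
    (fun j : Fin s => LinearMap.proj j ∘ₗ C.mulVecLin ∘ₗ fstL) d
    (π ∘ₗ fstL + sndL.smulRight a)
  rw [Fintype.card_sum, Fintype.card_fin, Fintype.card_fin] at h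
  convert h using 1
  ext x
  simp only [Set.mem_ofPred_eq, Set.mem_image, Sum.forall, Fin.forall_fin_two, Sum.elim_inl,
    Sum.elim_inr, Matrix.cons_val_zero, Matrix.cons_val_one, LinearMap.comp_apply,
    LinearMap.proj_apply, Matrix.mulVecLin_apply, LinearMap.neg_apply, LinearMap.add_apply,
    LinearMap.smul_apply, LinearMap.sum_apply, LinearMap.smulRight_apply, smul_eq_mul,
    LinearMap.fst_apply, LinearMap.snd_apply, fstL, sndL, Prod.exists, Pi.le_def, funext_iff,
    neg_nonpos, mul_comm (∑ i, a i ^ 2)]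
  constructor
  · rintro ⟨_, ⟨y, ⟨h₁, h₂⟩, hy⟩, t, ht, hvt, hx⟩
    obtain rfl := funext hy
    exact ⟨y, t, ⟨⟨h₁, ht, hvt⟩, h₂⟩, hx⟩
  · rintro ⟨y, t, ⟨⟨h₁, ht, hvt⟩, h₂⟩, hx⟩
    exact ⟨π y, ⟨y, ⟨h₁, h₂⟩, fun _ => rfl⟩, t, ht, hvt, hx⟩

/-- Reflection bound: if `P' ⊆ {x : ⟨a,x⟩ ≤ β}` is a nonempty
polytope and `φ_H` is the reflection through the hyperplane `⟨a,x⟩ = β`, then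
`xc(conv(P' ∪ φ_H(P'))) ≤ xc(P') + 2`. -/
theorem stmt5 {p : ℕ} (P' : Set (Fin p → ℝ)) (hpoly : IsPolytope P') (hne : P'.Nonempty)
    (a : Fin p → ℝ) (ha : a ≠ 0) (β : ℝ)
    (hsub : ∀ x ∈ P', (∑ i, a i * x i) ≤ β)
    (φ : (Fin p → ℝ) → (Fin p → ℝ))
    (hφ : ∀ x, φ x = x + (2 * (β - ∑ i, a i * x i) / (∑ i, a i ^ 2)) • a) :
    xc (convexHull ℝ (P' ∪ φ '' P')) ≤ xc P' + 2 := by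
  have hm : IsExtFormulation P' (xc P') := Nat.sInf_mem hpoly.exists_isExtFormulation
  have hconv : Convex ℝ P' := by
    obtain ⟨V, rfl⟩ := hpoly
    exact convex_convexHull ℝ _
  exact Nat.sInf_le (hm.convexHull_union_reflection hconv ha hsub hφ)
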